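/- Let Λ be a dominant weight, let x be Λ-minuscule or Λ-cominuscule, and let w be a Λ-(co)minuscule element with x ≤ w in Bruhat order, so that the heap H(x) is identified with an order ideal of the heap H(w). Let S(x) = {α simple root : ⟨x(Λ), α^∨⟩ ≥ 0} and let W_x be the subgroup of W generated by the simple reflections s_α for α ∈ S(x). If no element of H(w) ∖ H(x) has its color in c(Peak(x)) (the set of colors of peaks of H(x)), then w ∈ W_x·x, i.e. w = ux for some u ∈ W_x. -/

import Mathlib

namespace KM

/-! ## Jeu de taquin on posets (parametrized by an order relation `r`) -/

namespace JDT

variable {P : Type}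

/-- `S` is a lower set (order ideal) for the relation `r`. -/
def IsIdeal (r : P → P → Prop) (S : Set P) : Prop :=
  ∀ ⦃x y : P⦄, r x y → y ∈ S → x ∈ S

/-- `y` covers `x` for the order relation `r`. -/
def Cov (r : P → P → Prop) (x y : P) : Prop :=
  r x y ∧ x ≠ y ∧ ∀ z : P, r x z → r z y → z = x ∨ z = y

/-- A standard tableau for the order relation `r`: a finite set of boxes, labelled
strictly increasingly (w.r.t. `r`) and bijectively by `{1, …, n}`. -/
structure Tab (r : P → P → Prop) where
  dom : Set P
  finite : dom.Finite
  lab : P → ℕ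
  mono : ∀ ⦃x y : P⦄, x ∈ dom → y ∈ dom → r x y → x ≠ y → lab x < lab y
  bij : Set.BijOn lab dom (Set.Icc 1 dom.ncard)

/-- A configuration occurring during a jeu de taquin slide: a set of labelled boxes,
the labelling, and the position of the vacant box. -/
structure Cfg (P : Type) where
  dom : Set P
  lab : P → ℕ
  hole : P

/-- One elementary move inside a jeu de taquin slide: among the labelled boxes covering
the vacant box, the one with the smallest label moves its label into the vacant box,
becoming itself vacant. -/
def InnerStep (r : P → P → Prop) (s t : Cfg P) : Prop :=
  t.hole ∈ s.dom ∧ Cov r s.hole t.hole ∧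
  (∀ z ∈ s.dom, Cov r s.hole z → s.lab t.hole ≤ s.lab z) ∧
  t.dom = insert s.hole (s.dom \ {t.hole}) ∧
  t.lab s.hole = s.lab t.hole ∧ (∀ z : P, z ≠ s.hole → t.lab z = s.lab z)

/-- No labelled box covers the vacant box: the slide stops. -/
def Terminal (r : P → P → Prop) (s : Cfg P) : Prop :=
  ∀ z ∈ s.dom, ¬ Cov r s.hole z

/-- `x` is a valid vacant box to slide into: it lies strictly below some labelled box,
and is maximal among the unlabelled boxes lying strictly below some labelled box. -/
def IsSlideBox (r : P → P → Prop) (D : Set P) (x : P) : Prop :=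
  x ∉ D ∧ (∃ d ∈ D, r x d ∧ x ≠ d) ∧
  ∀ y : P, y ∉ D → (∃ d ∈ D, r y d ∧ y ≠ d) → r x y → x = y

/-- The jeu de taquin slide `j_x` : relation between the labelled configurations
before and after one full slide. -/
def SlideRel (r : P → P → Prop) (A B : Set P × (P → ℕ)) : Prop :=
  ∃ x : P, IsSlideBox r A.1 x ∧
    ∃ e : Cfg P, Relation.ReflTransGen (InnerStep r) ⟨A.1, A.2, x⟩ e ∧
      Terminal r e ∧ B.1 = e.dom ∧ B.2 = e.lab

/-- `R` is a rectification of `T`: it is obtained from `T` by iterating jeu de taquin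
slides, and its shape is an order ideal. -/
def RectifiesTo (r : P → P → Prop) (T R : Tab r) : Prop :=
  Relation.ReflTransGen (SlideRel r) (T.dom, T.lab) (R.dom, R.lab) ∧ IsIdeal r R.dom

/-- The poset has the jeu de taquin property: the rectification of any standard tableau
is independent of all choices made while performing the slides. -/
def HasJdt (r : P → P → Prop) : Prop :=
  ∀ T R R' : Tab r, RectifiesTo r T R → RectifiesTo r T R' → R.dom = R'.dom ∧ R.lab = R'.lab

open scoped Classical in
/-- The jeu de taquin number `t_{λ,μ}^ν`, relative to a choice `U` of a standard tableau
of each straight shape: the number of standard tableaux of skew shape `ν/λ` whose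
rectification is `U μ`; it is `0` if `λ ⊄ ν`. -/
noncomputable def tP (r : P → P → Prop) (U : Set P → Tab r) (lam mu nu : Set P) : ℕ :=
  if lam ⊆ nu then
    Set.ncard {T : Tab r | T.dom = nu \ lam ∧ RectifiesTo r T (U mu)}
  else 0

end JDT

/-! ## Symmetrizable generalized Cartan matrices and their Weyl groups -/

/-- A symmetrizable generalized Cartan matrix `a i j = ⟨α_j, α_i^∨⟩`, together with a
symmetrizer `d` (so that `(α_i, α_j) = d i * a i j` is a symmetric bilinear form with
`(α_i, α_i) = 2 * d i`). -/
structure SGCM (I : Type) where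
  a : I → I → ℤ
  d : I → ℝ
  a_diag : ∀ i, a i i = 2
  a_offdiag : ∀ i j, i ≠ j → a i j ≤ 0
  a_zero_iff : ∀ i j, a i j = 0 → a j i = 0
  d_pos : ∀ i, 0 < d i
  symm : ∀ i j, d i * (a i j : ℝ) = d j * (a j i : ℝ)

variable {I : Type}

/-- The squared length `(α_i, α_i)` of the `i`-th simple root. -/
def SGCM.normSq (G : SGCM I) (i : I) : ℝ := 2 * G.d i

/-- The dual (transposed) generalized Cartan matrix, corresponding to exchanging
roots and coroots. -/
noncomputable def SGCM.dual (G : SGCM I) : SGCM I where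
  a i j := G.a j i
  d i := (G.d i)⁻¹
  a_diag i := G.a_diag i
  a_offdiag i j h := G.a_offdiag j i (Ne.symm h)
  a_zero_iff i j h := G.a_zero_iff j i h
  d_pos i := inv_pos.mpr (G.d_pos i)
  symm i j := by
    have h := G.symm j i
    have hi : G.d i ≠ 0 := ne_of_gt (G.d_pos i)
    have hj : G.d j ≠ 0 := ne_of_gt (G.d_pos j)
    rw [inv_mul_eq_div, inv_mul_eq_div, div_eq_div_iff hi hj]
    linear_combination h

/-- The simple reflection `s_i` acting on weight coordinates: a weight `λ` is recorded
by its pairings `λ j = ⟨λ, α_j^∨⟩` with the simple coroots, and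
`⟨s_i λ, α_j^∨⟩ = ⟨λ, α_j^∨⟩ - ⟨λ, α_i^∨⟩ ⟨α_i, α_j^∨⟩`. -/
def SGCM.srefl (G : SGCM I) (i : I) : Equiv.Perm (I → ℝ) :=
  Function.Involutive.toPerm (fun lam j => lam j - lam i * (G.a j i : ℝ)) (by
    intro lam
    funext j
    have h2 : ((G.a i i : ℤ) : ℝ) = 2 := by rw [G.a_diag i]; norm_num
    dsimp only
    rw [h2]
    ring)

/-- The product `s_{l 1} ⋯ s_{l n}` of the simple reflections along a word. -/
def SGCM.wordProd (G : SGCM I) (l : List I) : Equiv.Perm (I → ℝ) :=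
  (l.map G.srefl).prod

/-- The length of an element of the Weyl group: the minimal length of a word of simple
reflections expressing it. -/
noncomputable def SGCM.length (G : SGCM I) (w : Equiv.Perm (I → ℝ)) : ℕ :=
  sInf {n | ∃ l : List I, l.length = n ∧ G.wordProd l = w}

/-- A word is reduced if no shorter word has the same product. -/
def SGCM.IsReduced (G : SGCM I) (l : List I) : Prop :=
  G.length (G.wordProd l) = l.length

/-- `w` belongs to the Weyl group (is a product of simple reflections). -/
def SGCM.InW (G : SGCM I) (w : Equiv.Perm (I → ℝ)) : Prop :=
  ∃ l : List I, G.wordProd l = w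

/-- The (strong) Bruhat order on the Weyl group, via the subword property. -/
def SGCM.bruhatLE (G : SGCM I) (u w : Equiv.Perm (I → ℝ)) : Prop :=
  ∃ l : List I, G.IsReduced l ∧ G.wordProd l = w ∧
    ∃ l' : List I, l'.Sublist l ∧ G.wordProd l' = u

/-- Peterson's condition: the word `[β_1, …, β_l]` satisfies
`s_{β_k} s_{β_{k+1}} ⋯ s_{β_l} (Λ) = s_{β_{k+1}} ⋯ s_{β_l} (Λ) - β_k`, i.e.
`⟨s_{β_{k+1}} ⋯ s_{β_l} (Λ), β_k^∨⟩ = 1`, for every `k`. -/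
def SGCM.MinusculeWord (G : SGCM I) (Λ : I → ℝ) : List I → Prop
  | [] => True
  | j :: l => G.MinusculeWord Λ l ∧ G.wordProd l Λ j = 1

/-- `w` is `Λ`-minuscule. -/
def SGCM.IsMinuscule (G : SGCM I) (Λ : I → ℝ) (w : Equiv.Perm (I → ℝ)) : Prop :=
  ∃ l : List I, G.IsReduced l ∧ G.wordProd l = w ∧ G.MinusculeWord Λ l

/-- `w` is `Λ`-cominuscule: it is `Λ^∨`-minuscule for the dual root system (where the
coweight `Λ^∨ = Σ Λ_i ϖ_i^∨` has the same coordinate function as `Λ`). -/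
def SGCM.IsCominuscule (G : SGCM I) (Λ : I → ℝ) (w : Equiv.Perm (I → ℝ)) : Prop :=
  ∃ l : List I, G.IsReduced l ∧ G.wordProd l = w ∧ G.dual.MinusculeWord Λ l

/-- `w` is `Λ`-minuscule or `Λ`-cominuscule. -/
def SGCM.IsCoMin (G : SGCM I) (Λ : I → ℝ) (w : Equiv.Perm (I → ℝ)) : Prop :=
  G.IsMinuscule Λ w ∨ G.IsCominuscule Λ w

/-- The simple reflection `s_i` acting on the root lattice `⊕ ℤ α_j` (an element is
recorded by its coordinates on the simple roots):
`s_i (x) = x - ⟨x, α_i^∨⟩ α_i` with `⟨Σ c_j α_j, α_i^∨⟩ = Σ c_j * a i j`. -/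
noncomputable def SGCM.qrefl (G : SGCM I) (i : I) : Equiv.Perm (I →₀ ℤ) :=
  Function.Involutive.toPerm
    (fun x => x - Finsupp.single i (x.sum fun j c => c * G.a i j))
    (by
      intro x
      dsimp only
      have hsub : ∀ y z : I →₀ ℤ,
          ((y - z).sum fun j c => c * G.a i j)
            = (y.sum fun j c => c * G.a i j) - (z.sum fun j c => c * G.a i j) :=
        fun y z => Finsupp.sum_sub_index (fun a b₁ b₂ => by ring)
      have hsingle : ∀ c : ℤ,
          ((Finsupp.single i c).sum fun j c' => c' * G.a i j) = c * 2 := by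
        intro c
        rw [Finsupp.sum_single_index (by ring), G.a_diag i]
      rw [hsub, hsingle]
      have h : (x.sum fun j c => c * G.a i j) - (x.sum fun j c => c * G.a i j) * 2
          = -(x.sum fun j c => c * G.a i j) := by ring
      rw [h, Finsupp.single_neg]
      abel)

/-- The product of the simple reflections along a word, acting on the root lattice. -/
noncomputable def SGCM.qword (G : SGCM I) (l : List I) : Equiv.Perm (I →₀ ℤ) :=
  (l.map G.qrefl).prod

/-! ## Heaps of fully commutative elements -/

/-- Generating relation for the heap order on the positions of a word: position `p` is
below position `q` when `p` comes later in the word and the corresponding simple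
reflections do not commute. -/
def heapBelow (G : SGCM I) (l : List I) (p q : Fin l.length) : Prop :=
  q.1 < p.1 ∧ G.srefl (l.get p) * G.srefl (l.get q) ≠ G.srefl (l.get q) * G.srefl (l.get p)

/-- The heap order on the positions of a word. -/
def heapLE (G : SGCM I) (l : List I) : Fin l.length → Fin l.length → Prop :=
  Relation.ReflTransGen (heapBelow G l)

/-- The subword of `l` consisting of the positions in `S`, in the order of the word. -/
noncomputable def idealWord (l : List I) (S : Set (Fin l.length)) : List I :=
  ((List.finRange l.length).filter fun p => @decide (p ∈ S) (Classical.propDecidable _)).map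
    l.get

open scoped Classical in
/-- The number `m(w)` attached to a `Λ`-(co)minuscule element with reduced word `l`:
the product of `(α, α) / (α_p, α_p)` over all pairs `(p, α)` where `p` is a position of
the word, `α` is a simple root with `⟨Λ, α^∨⟩ > 0` and `(α, α) > (α_p, α_p)`, and `p`
lies above the minimal `α`-coloured element `(α, 1)` of the heap (here `q` runs over the
positions and the first condition states that `q = (α, 1)` for `α` the colour of `q`). -/
noncomputable def mNum (G : SGCM I) (Λ : I → ℝ) (l : List I) : ℝ :=
  ∏ pq : Fin l.length × Fin l.length,
    if (∀ r, l.get r = l.get pq.2 → heapLE G l pq.2 r) ∧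
        0 < Λ (l.get pq.2) ∧
        G.normSq (l.get pq.1) < G.normSq (l.get pq.2) ∧
        heapLE G l pq.2 pq.1
    then G.normSq (l.get pq.2) / G.normSq (l.get pq.1)
    else 1

/-! ## Jeu de taquin numbers for (co)minuscule elements -/

/-- A valid system of choices for computing jeu de taquin numbers of `Λ`-(co)minuscule
elements: `wrd w` is a reduced word for `w`; for `u ≤ w`, `idl w u` is the order ideal
of the heap of `w` corresponding to `u`, and `tab w u` is a standard tableau whose shape
is that ideal. -/
def ValidChoices (G : SGCM I) (Λ : I → ℝ)
    (wrd : Equiv.Perm (I → ℝ) → List I)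
    (idl : (w u : Equiv.Perm (I → ℝ)) → Set (Fin (wrd w).length))
    (tab : (w u : Equiv.Perm (I → ℝ)) → JDT.Tab (heapLE G (wrd w))) : Prop :=
  (∀ w, G.IsCoMin Λ w → G.IsReduced (wrd w) ∧ G.wordProd (wrd w) = w) ∧
  (∀ w u, G.IsCoMin Λ w → G.bruhatLE u w →
      JDT.IsIdeal (heapLE G (wrd w)) (idl w u) ∧
      G.wordProd (idealWord (wrd w) (idl w u)) = u) ∧
  (∀ w u, G.IsCoMin Λ w → G.bruhatLE u w → (tab w u).dom = idl w u)

open scoped Classical in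
/-- The jeu de taquin number `t_{u,v}^w` of three Weyl group elements, computed in the
heap of `w`: the number of standard tableaux of shape `H(w)/λ(u)` rectifying to the
chosen standard tableau of shape `λ(v)`; it is `0` unless `u ≤ w` and `v ≤ w`. -/
noncomputable def tE (G : SGCM I)
    (wrd : Equiv.Perm (I → ℝ) → List I)
    (idl : (w u : Equiv.Perm (I → ℝ)) → Set (Fin (wrd w).length))
    (tab : (w u : Equiv.Perm (I → ℝ)) → JDT.Tab (heapLE G (wrd w)))
    (u v w : Equiv.Perm (I → ℝ)) : ℕ :=
  if G.bruhatLE u w ∧ G.bruhatLE v w then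
    Set.ncard {T : JDT.Tab (heapLE G (wrd w)) |
      T.dom = Set.univ \ idl w u ∧ JDT.RectifiesTo (heapLE G (wrd w)) T (tab w v)}
  else 0

/-- The number `m_{u,v}^w = m(w) / (m(u) · m(v))`. -/
noncomputable def mQuot (G : SGCM I) (Λ : I → ℝ)
    (wrd : Equiv.Perm (I → ℝ) → List I)
    (u v w : Equiv.Perm (I → ℝ)) : ℝ :=
  mNum G Λ (wrd w) / (mNum G Λ (wrd u) * mNum G Λ (wrd v))

/-- The set `S(x)` of simple roots `α` such that `⟨x(Λ), α^∨⟩ ≥ 0`. -/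
def Sx (G : SGCM I) (Λ : I → ℝ) (x : Equiv.Perm (I → ℝ)) : Set I :=
  {α : I | 0 ≤ x Λ α}

/-- The restriction of a symmetrizable GCM to a subset of the index set. -/
def SGCM.restrict (G : SGCM I) (S : Set I) : SGCM ↥S where
  a i j := G.a i.1 j.1
  d i := G.d i.1
  a_diag i := G.a_diag i.1
  a_offdiag i j h := G.a_offdiag i.1 j.1 (fun hv => h (Subtype.ext hv))
  a_zero_iff i j h := G.a_zero_iff i.1 j.1 h
  d_pos i := G.d_pos i.1
  symm i j := G.symm i.1 j.1

end KM

namespace KM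

namespace SGCM

variable {I : Type} (G : SGCM I)

theorem srefl_apply (i j : I) (v : I → ℝ) : G.srefl i v j = v j - v i * (G.a j i : ℝ) := rfl

theorem srefl_apply_self (i : I) (v : I → ℝ) : G.srefl i v i = - v i := by
  rw [srefl_apply, G.a_diag]; push_cast; ring

theorem srefl_srefl (i : I) (v : I → ℝ) : G.srefl i (G.srefl i v) = v := by
  funext j
  rw [srefl_apply, srefl_apply_self, srefl_apply]; ring

theorem srefl_mul_self (i : I) : G.srefl i * G.srefl i = 1 :=
  Equiv.ext fun v => G.srefl_srefl i v

theorem srefl_inv (i : I) : (G.srefl i)⁻¹ = G.srefl i :=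
  inv_eq_of_mul_eq_one_left (G.srefl_mul_self i)

theorem wordProd_nil : G.wordProd [] = 1 := rfl

theorem wordProd_cons (i : I) (l : List I) :
    G.wordProd (i :: l) = G.srefl i * G.wordProd l := by simp [wordProd]

theorem wordProd_append (l m : List I) :
    G.wordProd (l ++ m) = G.wordProd l * G.wordProd m := by simp [wordProd]

theorem wordProd_reverse (l : List I) : G.wordProd l.reverse = (G.wordProd l)⁻¹ := by
  induction l with
  | nil => simp [wordProd]
  | cons i l ih =>
    rw [List.reverse_cons, wordProd_append, ih, wordProd_cons, wordProd_cons, wordProd_nil,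
      mul_one, mul_inv_rev, srefl_inv]

theorem wordProd_cons_apply_self (i : I) (l : List I) (v : I → ℝ) :
    G.wordProd (i :: l) v i = - G.wordProd l v i := by
  rw [wordProd_cons, Equiv.Perm.mul_apply, srefl_apply_self]

theorem wordProd_cons_apply (i j : I) (l : List I) (v : I → ℝ) :
    G.wordProd (i :: l) v j = G.wordProd l v j - G.wordProd l v i * (G.a j i : ℝ) := by
  rw [wordProd_cons, Equiv.Perm.mul_apply, srefl_apply]

theorem wordProd_add (l : List I) (v v' : I → ℝ) (j : I) :
    G.wordProd l (v + v') j = G.wordProd l v j + G.wordProd l v' j := by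
  induction l generalizing j with
  | nil => rfl
  | cons i l ih => simp only [wordProd_cons_apply, ih]; ring

theorem wordProd_smul (l : List I) (c : ℝ) (v : I → ℝ) (j : I) :
    G.wordProd l (c • v) j = c * G.wordProd l v j := by
  induction l generalizing j with
  | nil => rfl
  | cons i l ih => simp only [wordProd_cons_apply, ih]; ring

theorem wordProd_sub (l : List I) (v v' : I → ℝ) (j : I) :
    G.wordProd l (v - v') j = G.wordProd l v j - G.wordProd l v' j := by
  have h := G.wordProd_add l (v - v') v' j
  rw [sub_add_cancel] at h
  linarith

theorem wordProd_congr (l : List I) {v v' : I → ℝ} {j : I} (hj : v j = v' j)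
    (h : ∀ i ∈ l, v i = v' i) : G.wordProd l v j = G.wordProd l v' j := by
  induction l generalizing j with
  | nil => exact hj
  | cons i l ih =>
    have h' : ∀ k ∈ l, v k = v' k := fun k hk => h k (List.mem_cons_of_mem _ hk)
    rw [wordProd_cons_apply, wordProd_cons_apply, ih hj h', ih (h i List.mem_cons_self) h']

theorem wordProd_integral (l : List I) {v : I → ℝ} (hv : ∀ j, ∃ n : ℤ, v j = n) (j : I) :
    ∃ n : ℤ, G.wordProd l v j = n := by
  induction l generalizing j with
  | nil => exact hv j
  | cons i l ih =>
    obtain ⟨n, hn⟩ := ih j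
    obtain ⟨m, hm⟩ := ih i
    exact ⟨n - m * G.a j i, by rw [wordProd_cons_apply, hn, hm]; push_cast; ring⟩

/-! ### The length function -/

theorem length_wordProd_le (l : List I) : G.length (G.wordProd l) ≤ l.length :=
  Nat.sInf_le ⟨l, rfl, rfl⟩

theorem exists_reduced {w : Equiv.Perm (I → ℝ)} (hw : G.InW w) :
    ∃ l : List I, l.length = G.length w ∧ G.wordProd l = w := by
  obtain ⟨l, hl⟩ := hw
  exact Nat.sInf_mem (s := {n | ∃ l : List I, l.length = n ∧ G.wordProd l = w}) ⟨_, l, rfl, hl⟩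

theorem InW.mul {G : SGCM I} {u v : Equiv.Perm (I → ℝ)} (hu : G.InW u) (hv : G.InW v) :
    G.InW (u * v) := by
  obtain ⟨l, rfl⟩ := hu
  obtain ⟨m, rfl⟩ := hv
  exact ⟨l ++ m, G.wordProd_append l m⟩

theorem inW_wordProd (l : List I) : G.InW (G.wordProd l) := ⟨l, rfl⟩

theorem inW_srefl (i : I) : G.InW (G.srefl i) := ⟨[i], by simp [wordProd]⟩

theorem length_mul_le {u v : Equiv.Perm (I → ℝ)} (hu : G.InW u) (hv : G.InW v) :
    G.length (u * v) ≤ G.length u + G.length v := by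
  obtain ⟨l, hl, rfl⟩ := G.exists_reduced hu
  obtain ⟨m, hm, rfl⟩ := G.exists_reduced hv
  rw [← hl, ← hm, ← List.length_append, ← wordProd_append]
  exact G.length_wordProd_le _

theorem length_srefl_mul_le (i : I) {v : Equiv.Perm (I → ℝ)} (hv : G.InW v) :
    G.length (G.srefl i * v) ≤ G.length v + 1 := by
  have h := G.length_mul_le (G.inW_srefl i) hv
  have h1 := G.length_wordProd_le [i]
  simp only [wordProd_cons, wordProd_nil, mul_one, List.length_singleton] at h1
  omega

theorem IsReduced.of_append {G : SGCM I} {l m : List I} (h : G.IsReduced (l ++ m)) :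
    G.IsReduced l ∧ G.IsReduced m := by
  unfold IsReduced at *
  rw [wordProd_append, List.length_append] at h
  have h1 := G.length_mul_le (G.inW_wordProd l) (G.inW_wordProd m)
  have h2 := G.length_wordProd_le l
  have h3 := G.length_wordProd_le m
  omega

theorem IsReduced.reverse {G : SGCM I} {l : List I} (h : G.IsReduced l) :
    G.IsReduced l.reverse := by
  refine le_antisymm (G.length_wordProd_le _) ?_
  obtain ⟨m, hm, hml⟩ := G.exists_reduced (G.inW_wordProd l.reverse)
  have h1 := G.length_wordProd_le m.reverse
  rw [wordProd_reverse, hml, wordProd_reverse, inv_inv, h, List.length_reverse, hm] at h1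
  rwa [List.length_reverse]

/-! ### Rank two -/

/-- The alternating word `[i, j, i, …]` with `n` letters. -/
def altWord (i j : I) : ℕ → List I
  | 0 => []
  | n + 1 => i :: altWord j i n

theorem length_altWord (i j : I) (n : ℕ) : (altWord i j n).length = n := by
  induction n generalizing i j with
  | zero => rfl
  | succ n ih => simp [altWord, ih]

theorem altWord_add (i j : I) (m n : ℕ) :
    ∃ t : List I, t.length = n ∧ altWord i j (m + n) = altWord i j m ++ t := by
  induction m generalizing i j with
  | zero => exact ⟨altWord i j n, length_altWord i j n, by simp [altWord]⟩
  | succ m ih =>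
    obtain ⟨t, ht, h⟩ := ih j i
    exact ⟨t, ht, by rw [Nat.add_right_comm]; simp [altWord, h]⟩

theorem altWord_apply_succ_succ (i j : I) (n : ℕ) (v : I → ℝ) :
    G.wordProd (altWord j i (n + 2)) v i =
      - G.wordProd (altWord j i n) v i - G.wordProd (altWord i j (n + 1)) v j * (G.a i j : ℝ) := by
  change G.wordProd (j :: altWord i j (n + 1)) v i = _
  rw [wordProd_cons_apply]
  congr 1
  exact G.wordProd_cons_apply_self _ _ _

theorem altWord_apply_one (i j : I) (v : I → ℝ) :
    G.wordProd (altWord j i 1) v i = v i - v j * (G.a i j : ℝ) :=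
  G.wordProd_cons_apply j i [] v

theorem srefl_comb_left (i j : I) (v : I → ℝ) (X Y : ℝ) :
    G.srefl i (fun k => v k - X * G.a k i - Y * G.a k j) =
      fun k => v k - (v i - X - Y * G.a i j) * G.a k i - Y * G.a k j := by
  funext k
  rw [srefl_apply, G.a_diag]
  push_cast
  ring

theorem srefl_comb_right (i j : I) (v : I → ℝ) (X Y : ℝ) :
    G.srefl j (fun k => v k - X * G.a k i - Y * G.a k j) =
      fun k => v k - X * G.a k i - (v j - Y - X * G.a j i) * G.a k j := by
  funext k
  rw [srefl_apply, G.a_diag]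
  push_cast
  ring

/-- In a dihedral parabolic subgroup of infinite order every alternating word keeps the
opposite coordinate nonnegative. -/
theorem altWord_nonneg_of_four_le {i j : I} (hij : i ≠ j) (h4 : 4 ≤ G.a i j * G.a j i)
    {v : I → ℝ} (hi : 0 ≤ v i) (hj : 0 ≤ v j) (n : ℕ) :
    0 ≤ G.wordProd (altWord j i n) v i := by
  have ha : (G.a i j : ℝ) ≤ 0 := by exact_mod_cast G.a_offdiag i j hij
  have hb : (G.a j i : ℝ) ≤ 0 := by exact_mod_cast G.a_offdiag j i hij.symm
  have hab : (4 : ℝ) ≤ G.a i j * G.a j i := by exact_mod_cast h4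
  have key : ∀ n, 0 ≤ G.wordProd (altWord j i n) v i ∧ 0 ≤ G.wordProd (altWord i j n) v j ∧
      - (G.a i j : ℝ) * G.wordProd (altWord i j n) v j
        ≤ 2 * G.wordProd (altWord j i (n + 1)) v i ∧
      - (G.a j i : ℝ) * G.wordProd (altWord j i n) v i
        ≤ 2 * G.wordProd (altWord i j (n + 1)) v j := by
    intro n
    induction n with
    | zero =>
      rw [altWord_apply_one, altWord_apply_one]
      change 0 ≤ v i ∧ 0 ≤ v j ∧ - (G.a i j : ℝ) * v j ≤ _ ∧ - (G.a j i : ℝ) * v i ≤ _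
      refine ⟨hi, hj, ?_, ?_⟩ <;> nlinarith
    | succ n ih =>
      obtain ⟨h1, h2, h3, h5⟩ := ih
      rw [altWord_apply_succ_succ, altWord_apply_succ_succ]
      refine ⟨?_, ?_, ?_, ?_⟩
      · nlinarith
      · nlinarith
      · nlinarith [mul_nonneg (neg_nonneg.2 ha) (sub_nonneg.2 h5),
          mul_nonneg (sub_nonneg.2 hab) h1]
      · nlinarith [mul_nonneg (neg_nonneg.2 hb) (sub_nonneg.2 h3),
          mul_nonneg (sub_nonneg.2 hab) h2]
  exact (key n).1

/-- In a dihedral parabolic subgroup of finite order, alternating words shorter than the longest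
element keep the opposite coordinate nonnegative, and the braid relation holds. -/
theorem exists_braid_of_lt_four {i j : I} (hij : i ≠ j) (h4 : G.a i j * G.a j i < 4) :
    ∃ m : ℕ, G.wordProd (altWord i j (m + 2)) = G.wordProd (altWord j i m) ∧
      ∀ n ≤ m, ∀ v : I → ℝ, 0 ≤ v i → 0 ≤ v j → 0 ≤ G.wordProd (altWord j i n) v i := by
  have ha : G.a i j ≤ 0 := G.a_offdiag i j hij
  have hb : G.a j i ≤ 0 := G.a_offdiag j i hij.symm
  have h0 := G.a_zero_iff i j
  have h0' := G.a_zero_iff j i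
  have hcases : (G.a i j = 0 ∧ G.a j i = 0) ∨ (G.a i j = -1 ∧ G.a j i = -1) ∨
      (G.a i j = -1 ∧ G.a j i = -2) ∨ (G.a i j = -2 ∧ G.a j i = -1) ∨
      (G.a i j = -1 ∧ G.a j i = -3) ∨ (G.a i j = -3 ∧ G.a j i = -1) := by
    by_cases hz : G.a i j = 0
    · exact Or.inl ⟨hz, h0 hz⟩
    · have hz' : G.a j i ≠ 0 := fun h => hz (h0' h)
      have ha1 : G.a i j ≤ -1 := by omega
      have hb1 : G.a j i ≤ -1 := by omega
      have ha3 : -3 ≤ G.a i j := by nlinarith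
      have hb3 : -3 ≤ G.a j i := by nlinarith
      generalize G.a i j = A at *
      generalize G.a j i = B at *
      interval_cases A <;> interval_cases B <;> simp_all
  have start : ∀ v : I → ℝ, v = fun k => v k - 0 * G.a k i - 0 * G.a k j := by
    intro v; funext k; ring
  have x0 : ∀ v : I → ℝ, G.wordProd (altWord j i 0) v i = v i := fun _ => rfl
  have y0 : ∀ v : I → ℝ, G.wordProd (altWord i j 0) v j = v j := fun _ => rfl
  have x1 := G.altWord_apply_one i j
  have y1 := G.altWord_apply_one j i
  have x2 := G.altWord_apply_succ_succ i j 0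
  have y2 := G.altWord_apply_succ_succ j i 0
  have x3 := G.altWord_apply_succ_succ i j 1
  have y3 := G.altWord_apply_succ_succ j i 1
  have x4 := G.altWord_apply_succ_succ i j 2
  have y4 := G.altWord_apply_succ_succ j i 2
  have x5 := G.altWord_apply_succ_succ i j 3
  norm_num only at x2 y2 x3 y3 x4 y4 x5
  have braid : ∀ m : ℕ, (∀ v : I → ℝ, G.wordProd (altWord i j (m + 2))
      (fun k => v k - 0 * G.a k i - 0 * G.a k j) = G.wordProd (altWord j i m)
      (fun k => v k - 0 * G.a k i - 0 * G.a k j)) →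
      G.wordProd (altWord i j (m + 2)) = G.wordProd (altWord j i m) := by
    intro m h
    ext1 v
    rw [start v]
    exact h v
  rcases hcases with ⟨hA, hB⟩ | ⟨hA, hB⟩ | ⟨hA, hB⟩ | ⟨hA, hB⟩ | ⟨hA, hB⟩ | ⟨hA, hB⟩
  on_goal 1 => refine ⟨1, braid 1 fun v => ?_, fun n hn v hi hj => ?_⟩
  on_goal 3 => refine ⟨2, braid 2 fun v => ?_, fun n hn v hi hj => ?_⟩
  on_goal 5 => refine ⟨3, braid 3 fun v => ?_, fun n hn v hi hj => ?_⟩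
  on_goal 7 => refine ⟨3, braid 3 fun v => ?_, fun n hn v hi hj => ?_⟩
  on_goal 9 => refine ⟨5, braid 5 fun v => ?_, fun n hn v hi hj => ?_⟩
  on_goal 11 => refine ⟨5, braid 5 fun v => ?_, fun n hn v hi hj => ?_⟩
  all_goals first
    | (interval_cases n <;> simp only [x0, x1, x2, x3, x4, x5, y0, y1, y2, y3, y4, hA, hB] <;>
        push_cast <;> linarith)
    | (simp only [altWord, wordProd_cons, wordProd_nil, mul_one, Equiv.Perm.mul_apply,
        srefl_comb_left, srefl_comb_right, hA, hB]
       funext k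
       push_cast
       ring)

theorem IsReduced.eq_altWord {G : SGCM I} {u : List I} (hu : G.IsReduced u) {i j : I}
    (hmem : ∀ k ∈ u, k = i ∨ k = j) (hhead : ∀ t, u ≠ i :: t) : u = altWord j i u.length := by
  induction u generalizing i j with
  | nil => rfl
  | cons k u ih =>
    obtain rfl : k = j := (hmem k List.mem_cons_self).resolve_left fun h => hhead u (by rw [h])
    have hu' : G.IsReduced u := (IsReduced.of_append (l := [k]) hu).2
    have hne : ∀ t, u ≠ k :: t := by
      rintro t rfl
      have h1 := G.length_wordProd_le t
      have h2 : G.wordProd (k :: k :: t) = G.wordProd t := by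
        rw [wordProd_cons, wordProd_cons, ← mul_assoc, srefl_mul_self, one_mul]
      unfold IsReduced at hu
      rw [h2] at hu
      simp only [List.length_cons] at hu
      omega
    have h := ih hu' (fun l hl => (hmem l (List.mem_cons_of_mem _ hl)).symm) hne
    rw [List.length_cons, altWord, ← h]

/-- The rank two case of the positivity theorem. -/
theorem dihedral_nonneg {i j : I} (hij : i ≠ j) {u : List I} (hu : G.IsReduced u)
    (hmem : ∀ k ∈ u, k = i ∨ k = j) (hlen : u.length ≤ G.length (G.srefl i * G.wordProd u))
    {v : I → ℝ} (hi : 0 ≤ v i) (hj : 0 ≤ v j) : 0 ≤ G.wordProd u v i := by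
  have hhead : ∀ t, u ≠ i :: t := by
    rintro t rfl
    rw [wordProd_cons, ← mul_assoc, srefl_mul_self, one_mul] at hlen
    have := G.length_wordProd_le t
    simp only [List.length_cons] at hlen
    omega
  have halt := hu.eq_altWord hmem hhead
  rcases le_or_gt 4 (G.a i j * G.a j i) with h4 | h4
  · rw [halt]
    exact G.altWord_nonneg_of_four_le hij h4 hi hj _
  · obtain ⟨m, hbraid, hpos⟩ := G.exists_braid_of_lt_four hij h4
    rcases le_or_gt u.length m with hm | hm
    · rw [halt]
      exact hpos _ hm v hi hj
    · exfalso
      obtain ⟨r, hr⟩ := Nat.exists_eq_add_of_lt hm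
      rw [show m + r + 1 = (m + 1) + r by omega] at hr
      obtain ⟨t, ht, hsplit⟩ := altWord_add j i (m + 1) r
      have hprod : G.srefl i * G.wordProd u = G.wordProd (altWord j i m ++ t) := by
        rw [halt, hr, hsplit, ← wordProd_cons, ← List.cons_append, wordProd_append,
          wordProd_append, ← hbraid]
        rfl
      rw [hprod] at hlen
      have := G.length_wordProd_le (altWord j i m ++ t)
      rw [List.length_append, length_altWord] at this
      omega

/-! ### Positivity of real coroots -/

/-- If `s_i w` is not shorter than `w`, then `w⁻¹ α_i^∨` is a nonnegative combination of simple
coroots: it is nonnegative on every dominant weight. -/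
theorem apply_nonneg_of_length_le {w : Equiv.Perm (I → ℝ)} (hw : G.InW w) {i : I}
    (hlen : G.length w ≤ G.length (G.srefl i * w)) {v : I → ℝ} (hv : ∀ j, 0 ≤ v j) :
    0 ≤ w v i := by
  induction hn : G.length w using Nat.strong_induction_on generalizing w i with
  | _ n ih =>
    subst hn
    obtain ⟨l, hl, hlw⟩ := G.exists_reduced hw
    cases l with
    | nil =>
      rw [← hlw]
      exact hv i
    | cons j l =>
      have hjw : G.srefl j * w = G.wordProd l := by
        rw [← hlw, wordProd_cons, ← mul_assoc, srefl_mul_self, one_mul]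
      have hjlen : G.length (G.srefl j * w) < G.length w := by
        have := G.length_wordProd_le l
        rw [hjw, ← hl, List.length_cons]
        omega
      have hij : i ≠ j := by
        rintro rfl
        omega
      classical
      let Q : ℕ → Prop := fun k => ∃ (u : List I) (y : Equiv.Perm (I → ℝ)),
        (∀ k ∈ u, k = i ∨ k = j) ∧ G.InW y ∧ G.wordProd u * y = w ∧
          u.length + G.length y = G.length w ∧ G.length y = k
      have hQ : Q (G.length (G.srefl j * w)) := by
        refine ⟨[j], G.srefl j * w, by simp, (G.inW_srefl j).mul hw, ?_, ?_, rfl⟩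
        · rw [wordProd_cons, wordProd_nil, mul_one, ← mul_assoc, srefl_mul_self, one_mul]
        · have := G.length_srefl_mul_le j ((G.inW_srefl j).mul hw)
          rw [← mul_assoc, srefl_mul_self, one_mul] at this
          rw [List.length_singleton]
          omega
      have hex : ∃ k, Q k := ⟨_, hQ⟩
      obtain ⟨u, y, hu, hy, huy, hsum, hk⟩ := Nat.find_spec hex
      have hle : Nat.find hex ≤ G.length (G.srefl j * w) := Nat.find_min' hex hQ
      have hmin : ∀ k, k = i ∨ k = j → G.length y ≤ G.length (G.srefl k * y) := by
        intro k hkij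
        by_contra! hlt
        have h1 := G.length_srefl_mul_le k ((G.inW_srefl k).mul hy)
        rw [← mul_assoc, srefl_mul_self, one_mul] at h1
        refine Nat.find_min hex (m := G.length (G.srefl k * y)) (by omega)
          ⟨u ++ [k], G.srefl k * y, ?_, (G.inW_srefl k).mul hy, ?_, ?_, rfl⟩
        · intro k' hk'
          rcases List.mem_append.1 hk' with h | h
          · exact hu k' h
          · rw [List.mem_singleton.1 h]
            exact hkij
        · rw [wordProd_append, wordProd_cons, wordProd_nil, mul_one, mul_assoc,
            ← mul_assoc (G.srefl k), srefl_mul_self, one_mul, huy]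
        · rw [List.length_append, List.length_singleton]
          omega
      have hyi : 0 ≤ y v i := ih _ (by omega) hy (hmin i (Or.inl rfl)) rfl
      have hyj : 0 ≤ y v j := ih _ (by omega) hy (hmin j (Or.inr rfl)) rfl
      rw [← huy, Equiv.Perm.mul_apply]
      refine G.dihedral_nonneg hij ?_ hu ?_ hyi hyj
      · have h1 := G.length_mul_le (G.inW_wordProd u) hy
        have h2 := G.length_wordProd_le u
        rw [huy] at h1
        unfold IsReduced
        omega
      · have h1 := G.length_mul_le ((G.inW_srefl i).mul (G.inW_wordProd u)) hy
        rw [mul_assoc, huy] at h1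
        omega

theorem apply_nonpos_of_length_lt {w : Equiv.Perm (I → ℝ)} (hw : G.InW w) {i : I}
    (hlen : G.length (G.srefl i * w) < G.length w) {v : I → ℝ} (hv : ∀ j, 0 ≤ v j) :
    w v i ≤ 0 := by
  have h := G.apply_nonneg_of_length_le ((G.inW_srefl i).mul hw) (i := i) (v := v)
    (by rw [← mul_assoc, srefl_mul_self, one_mul]; exact hlen.le) hv
  rw [Equiv.Perm.mul_apply, srefl_apply_self] at h
  linarith

theorem IsReduced.apply_nonneg {G : SGCM I} {i : I} {l : List I} (h : G.IsReduced (i :: l))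
    {v : I → ℝ} (hv : ∀ j, 0 ≤ v j) : 0 ≤ G.wordProd l v i := by
  refine G.apply_nonneg_of_length_le (G.inW_wordProd l) ?_ hv
  rw [← wordProd_cons, h, List.length_cons]
  exact (G.length_wordProd_le l).trans (Nat.le_succ _)

/-- A linear form which vanishes on nonnegative weights vanishes. -/
theorem wordProd_eq_zero_of_nonneg {l : List I} {i : I} (S : Set I)
    (h : ∀ v : I → ℝ, (∀ j, 0 ≤ v j) → (∀ j ∈ S, v j = 0) → G.wordProd l v i = 0)
    (v : I → ℝ) (hv : ∀ j ∈ S, v j = 0) : G.wordProd l v i = 0 := by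
  have hdecomp : v = (fun j => max (v j) 0) - fun j => max (-v j) 0 := by
    funext j
    simp only [Pi.sub_apply]
    rcases le_total (v j) 0 with h | h
    · rw [max_eq_right h, max_eq_left (by linarith)]; ring
    · rw [max_eq_left h, max_eq_right (by linarith)]; ring
  rw [hdecomp, wordProd_sub, h _ (fun j => le_max_right _ _) (fun j hj => by simp [hv j hj]),
    h _ (fun j => le_max_right _ _) (fun j hj => by simp [hv j hj]), sub_zero]

/-- A positive real coroot made negative by `s_j` is the simple coroot `α_j^∨`. -/
theorem apply_eq_of_pos_of_neg {l : List I} {i j : I}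
    (hpos : ∀ v : I → ℝ, (∀ k, 0 ≤ v k) → 0 ≤ G.wordProd l v i)
    (hneg : ∀ v : I → ℝ, (∀ k, 0 ≤ v k) → G.wordProd l (G.srefl j v) i ≤ 0) (v : I → ℝ) :
    G.wordProd l v i = v j := by
  classical
  have hzero : ∀ v : I → ℝ, (∀ k ∈ ({j} : Set I), v k = 0) → G.wordProd l v i = 0 := by
    refine G.wordProd_eq_zero_of_nonneg {j} fun v hv hvj => le_antisymm ?_ (hpos v hv)
    have hfix : G.srefl j v = v := by
      funext k
      rw [srefl_apply, hvj j rfl, zero_mul, sub_zero]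
    simpa [hfix] using hneg v hv
  have hint : ∀ k, ∀ k', ∃ n : ℤ, (Pi.single k 1 : I → ℝ) k' = n := by
    intro k k'
    by_cases h : k' = k
    · subst h; exact ⟨1, by simp⟩
    · exact ⟨0, by simp [h]⟩
  obtain ⟨m, hm⟩ := G.wordProd_integral l (hint j) i
  have hlin : ∀ v : I → ℝ, G.wordProd l v i = v j * m := by
    intro v
    have h1 := hzero (v - v j • Pi.single j 1) (by simp)
    rw [wordProd_sub, wordProd_smul, hm] at h1
    linarith
  obtain ⟨n, hn⟩ := G.wordProd_integral l.reverse (hint i) j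
  have h1 := hlin (G.wordProd l.reverse (Pi.single i 1))
  rw [hn, wordProd_reverse, ← Equiv.Perm.mul_apply, mul_inv_cancel, Equiv.Perm.one_apply,
    Pi.single_eq_same] at h1
  have h2 : n * m = 1 := by exact_mod_cast h1.symm
  have hm0 : 0 ≤ m := by
    have := hpos (Pi.single j 1) (fun k => by
      by_cases h : k = j
      · subst h; simp
      · simp [h])
    rw [hm] at this
    exact_mod_cast this
  have hm1 : m = 1 := by
    rcases Int.isUnit_iff.1 (IsUnit.of_mul_eq_one n (by linarith : m * n = 1)) with h | h
    · exact h
    · omega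
  rw [hlin, hm1]
  simp

/-! ### Minuscule words -/

/-- If `l` is a `Λ`-minuscule word, then every positive real coroot made negative by the product
of `l` pairs to `1` with `Λ`. The coroot is recorded as the linear form `v ↦ (y v) i`. -/
theorem MinusculeWord.apply_eq_one {G : SGCM I} {Λ : I → ℝ} {l : List I}
    (hl : G.MinusculeWord Λ l) {y : List I} {i : I}
    (hpos : ∀ v : I → ℝ, (∀ k, 0 ≤ v k) → 0 ≤ G.wordProd y v i)
    (hneg : ∀ v : I → ℝ, (∀ k, 0 ≤ v k) → G.wordProd (y ++ l.reverse) v i ≤ 0) :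
    G.wordProd y Λ i = 1 := by
  induction l with
  | nil =>
    exfalso
    have h := G.wordProd_eq_zero_of_nonneg (l := y) (i := i) ∅
      (fun v hv _ => le_antisymm (by simpa using hneg v hv) (hpos v hv))
      ((G.wordProd y)⁻¹ fun _ => 1) (by simp)
    rw [← Equiv.Perm.mul_apply, mul_inv_cancel, Equiv.Perm.one_apply] at h
    exact one_ne_zero h
  | cons j l ih =>
    by_cases hd : G.length (G.wordProd (y ++ l.reverse)) ≤
        G.length (G.srefl i * G.wordProd (y ++ l.reverse))
    · have h := G.apply_eq_of_pos_of_neg (l := y ++ l.reverse) (i := i) (j := j)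
        (fun v hv => G.apply_nonneg_of_length_le (G.inW_wordProd _) hd hv)
        (fun v hv => by
          have := hneg v hv
          rwa [List.reverse_cons, ← List.append_assoc, wordProd_append, wordProd_cons, wordProd_nil,
            mul_one, Equiv.Perm.mul_apply] at this)
        (G.wordProd l Λ)
      rw [hl.2, wordProd_append, wordProd_reverse, Equiv.Perm.mul_apply,
        ← Equiv.Perm.mul_apply (G.wordProd l)⁻¹, inv_mul_cancel, Equiv.Perm.one_apply] at h
      exact h
    · exact ih hl.1 fun v hv =>
        G.apply_nonpos_of_length_lt (G.inW_wordProd _) (not_le.1 hd) hv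

/-- A suffix of a reduced word of a `Λ`-minuscule element is a `Λ`-minuscule word. -/
theorem MinusculeWord.of_isReduced_append {G : SGCM I} {Λ : I → ℝ} {l : List I}
    (hl : G.MinusculeWord Λ l) {u m : List I} (hred : G.IsReduced (u ++ m))
    (hprod : G.wordProd (u ++ m) = G.wordProd l) : G.MinusculeWord Λ m := by
  induction m generalizing u with
  | nil => trivial
  | cons i m ih =>
    refine ⟨ih (u := u ++ [i]) (by simpa using hred) (by simpa using hprod), ?_⟩
    refine hl.apply_eq_one (fun v hv => hred.of_append.2.apply_nonneg hv) fun v hv => ?_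
    have hrev : G.IsReduced (i :: u.reverse) := by
      have := (IsReduced.of_append (l := u ++ [i]) (m := m) (by simpa using hred)).1.reverse
      simpa using this
    have heq : G.wordProd (m ++ l.reverse) = G.wordProd (i :: u.reverse) := by
      rw [wordProd_append, wordProd_reverse, ← hprod, wordProd_cons, wordProd_reverse,
        wordProd_append, wordProd_cons, mul_inv_rev, mul_inv_rev, srefl_inv]
      group
    rw [heq, wordProd_cons_apply_self]
    have := hrev.apply_nonneg hv
    linarith

/-- If a minuscule word takes a dominant weight to a weight negative on `α_i^∨`, then `i` occurs
in the word, preceded only by letters orthogonal to it. -/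
theorem MinusculeWord.exists_eq_append {G : SGCM I} {Λ : I → ℝ} (hΛ : ∀ i, 0 ≤ Λ i) {m : List I}
    (hm : G.MinusculeWord Λ m) {i : I} (hi : G.wordProd m Λ i < 0) :
    G.wordProd m Λ i = -1 ∧ ∃ A B, m = A ++ i :: B ∧ ∀ j ∈ A, G.a i j = 0 := by
  induction m with
  | nil => exact absurd (hΛ i) (not_le.2 hi)
  | cons j m ih =>
    by_cases hij : j = i
    · subst hij
      exact ⟨by rw [wordProd_cons_apply_self, hm.2], [], m, rfl, by simp⟩
    · rw [wordProd_cons_apply, hm.2, one_mul] at hi ⊢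
      have ha : G.a i j ≤ 0 := G.a_offdiag i j (Ne.symm hij)
      have ha' : (G.a i j : ℝ) ≤ 0 := by exact_mod_cast ha
      obtain ⟨h1, A, B, rfl, hA⟩ := ih hm.1 (by linarith)
      have ha0 : G.a i j = 0 := by
        by_contra hne
        have : (G.a i j : ℝ) ≤ -1 := by exact_mod_cast (by omega : G.a i j ≤ -1)
        linarith
      refine ⟨by rw [h1, ha0]; simp, j :: A, B, rfl, ?_⟩
      simpa [ha0] using hA

/-! ### The dual Weyl group -/

theorem dual_wordProd_apply (l : List I) (v : I → ℝ) (j : I) :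
    G.dual.wordProd l v j = G.d j * G.wordProd l (fun k => v k / G.d k) j := by
  induction l generalizing j with
  | nil =>
    have := (G.d_pos j).ne'
    change v j = G.d j * (v j / G.d j)
    field_simp
  | cons i l ih =>
    rw [wordProd_cons_apply, wordProd_cons_apply, ih, ih, mul_sub, mul_assoc, mul_left_comm,
      mul_left_comm (G.d j), ← G.symm i j]
    change _ - _ * (_ * (G.a i j : ℝ)) = _
    ring

theorem wordProd_apply_eq_dual (l : List I) (v : I → ℝ) (j : I) :
    G.wordProd l v j = G.dual.wordProd l (fun k => v k * G.d k) j / G.d j := by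
  have h : (fun k => v k * G.d k / G.d k) = v := by
    funext k
    exact mul_div_cancel_right₀ _ (G.d_pos k).ne'
  rw [dual_wordProd_apply, h, mul_div_cancel_left₀ _ (G.d_pos j).ne']

theorem dual_wordProd_eq_iff {l m : List I} :
    G.dual.wordProd l = G.dual.wordProd m ↔ G.wordProd l = G.wordProd m := by
  constructor <;> intro h <;> ext v j
  · rw [wordProd_apply_eq_dual, h, ← wordProd_apply_eq_dual]
  · rw [dual_wordProd_apply, h, ← dual_wordProd_apply]

theorem dual_isReduced_iff {l : List I} : G.dual.IsReduced l ↔ G.IsReduced l := by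
  unfold IsReduced length
  simp only [dual_wordProd_eq_iff]

/-- The sign of `⟨x Λ, α_i^∨⟩` does not change when passing to the dual root system. -/
theorem dual_wordProd_apply_neg {m : List I} {Λ : I → ℝ} (hΛ : ∀ i, 0 ≤ Λ i) {i : I}
    (hi : G.wordProd m Λ i < 0) : G.dual.wordProd m Λ i < 0 := by
  have hlen : G.length (G.srefl i * G.wordProd m) < G.length (G.wordProd m) := by
    by_contra! h
    exact absurd (G.apply_nonneg_of_length_le (G.inW_wordProd m) h hΛ) (not_le.2 hi)
  have hbound : ∀ s : List I, ∃ c : ℝ, 0 < c ∧ ∀ k ∈ s, c ≤ 1 / G.d k := by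
    intro s
    induction s with
    | nil => exact ⟨1, one_pos, by simp⟩
    | cons k s ih =>
      obtain ⟨c, hc, hs⟩ := ih
      refine ⟨min c (1 / G.d k), lt_min hc (one_div_pos.2 (G.d_pos k)), fun k' hk' => ?_⟩
      rcases List.mem_cons.1 hk' with rfl | h
      · exact min_le_right _ _
      · exact (min_le_left _ _).trans (hs k' h)
  obtain ⟨c, hc, hs⟩ := hbound (i :: m)
  have hval : ∀ k ∈ i :: m,
      Λ k / G.d k = (c • Λ + fun k => max (Λ k / G.d k - c * Λ k) 0) k := by
    intro k hk
    have h := mul_le_mul_of_nonneg_right (hs k hk) (hΛ k)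
    rw [one_div_mul_eq_div] at h
    simp only [Pi.add_apply, Pi.smul_apply, smul_eq_mul]
    rw [max_eq_left (by linarith)]
    ring
  rw [dual_wordProd_apply, G.wordProd_congr m (hval i List.mem_cons_self)
    fun k hk => hval k (List.mem_cons_of_mem _ hk), wordProd_add, wordProd_smul]
  have h1 := G.apply_nonpos_of_length_lt (G.inW_wordProd m) hlen
    (v := fun k => max (Λ k / G.d k - c * Λ k) 0) fun k => le_max_right _ _
  exact mul_neg_of_pos_of_neg (G.d_pos i) (by linarith [mul_neg_of_pos_of_neg hc hi])

theorem srefl_commute {i j : I} (h : G.a i j = 0) : Commute (G.srefl i) (G.srefl j) := by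
  have h' := G.a_zero_iff i j h
  refine Equiv.ext fun v => funext fun k => ?_
  simp only [Equiv.Perm.mul_apply, srefl_apply, h, h']
  push_cast
  ring

/-- If `x ≤ w` is a final part of a reduced word of the `Λ`-(co)minuscule element `w` and
`⟨x Λ, α_i^∨⟩ < 0`, then `i` occurs in the word of `x`, preceded only by letters commuting
with it. -/
theorem IsCoMin.exists_eq_append {G : SGCM I} {Λ : I → ℝ} (hΛ : ∀ i, 0 ≤ Λ i)
    {w : Equiv.Perm (I → ℝ)} (hw : G.IsCoMin Λ w) {u m : List I} (hred : G.IsReduced (u ++ m))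
    (hprod : G.wordProd (u ++ m) = w) {i : I} (hi : G.wordProd m Λ i < 0) :
    ∃ A B, m = A ++ i :: B ∧ ∀ j ∈ A, Commute (G.srefl i) (G.srefl j) := by
  rcases hw with ⟨l, -, hlw, hl⟩ | ⟨l, -, hlw, hl⟩
  · have hm := hl.of_isReduced_append hred (hprod.trans hlw.symm)
    obtain ⟨-, A, B, h, hA⟩ := hm.exists_eq_append hΛ hi
    exact ⟨A, B, h, fun j hj => G.srefl_commute (hA j hj)⟩
  · have hm := hl.of_isReduced_append (G.dual_isReduced_iff.2 hred)
      (G.dual_wordProd_eq_iff.2 (hprod.trans hlw.symm))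
    obtain ⟨-, A, B, h, hA⟩ := hm.exists_eq_append hΛ (G.dual_wordProd_apply_neg hΛ hi)
    exact ⟨A, B, h, fun j hj => (G.srefl_commute (hA j hj : G.a j i = 0)).symm⟩

/-! ### Order ideals of heaps -/

theorem prod_filter_mul_prod_filter {M T : Type*} [Monoid M] (f : T → M) (p : T → Prop)
    [DecidablePred p] (L : List T)
    (h : L.Pairwise fun a b => p a → ¬ p b → Commute (f a) (f b)) :
    ((L.filter fun a => ¬ p a).map f).prod * ((L.filter fun a => p a).map f).prod =
      (L.map f).prod := by
  induction L with
  | nil => simp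
  | cons a L ih =>
    rw [List.pairwise_cons] at h
    by_cases ha : p a
    · have hc : Commute (f a) ((L.filter fun a => ¬ p a).map f).prod := by
        refine Commute.list_prod_right _ _ fun y hy => ?_
        obtain ⟨b, hb, rfl⟩ := List.mem_map.1 hy
        rw [List.mem_filter] at hb
        exact h.1 b hb.1 ha (by simpa using hb.2)
      simp only [List.filter_cons, ha, not_true_eq_false, decide_false, decide_true, if_true,
        List.map_cons, List.prod_cons, Bool.false_eq_true, if_false]
      rw [← mul_assoc, ← hc.eq, mul_assoc, ih h.2]
    · simp only [List.filter_cons, ha, not_false_eq_true, decide_false, decide_true, if_true,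
        List.map_cons, List.prod_cons, Bool.false_eq_true, if_false]
      rw [mul_assoc, ih h.2]

theorem idealWord_eq (l : List I) (S : Set (Fin l.length)) [DecidablePred (· ∈ S)] :
    idealWord l S = ((List.finRange l.length).filter fun p => p ∈ S).map l.get := by
  unfold idealWord
  congr!

theorem length_idealWord_compl_add (l : List I) (S : Set (Fin l.length)) :
    (idealWord l Sᶜ).length + (idealWord l S).length = l.length := by
  classical
  rw [idealWord_eq, idealWord_eq, List.length_map, List.length_map]
  have h := List.length_eq_length_filter_add (l := List.finRange l.length)
    fun p => decide (p ∈ S)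
  rw [List.length_finRange] at h
  simp only [Set.mem_compl_iff, decide_not]
  omega

theorem wordProd_idealWord_compl_append {G : SGCM I} {l : List I} {S : Set (Fin l.length)}
    (hS : JDT.IsIdeal (heapLE G l) S) :
    G.wordProd (idealWord l Sᶜ ++ idealWord l S) = G.wordProd l := by
  classical
  have h := prod_filter_mul_prod_filter (fun p : Fin l.length => G.srefl (l.get p)) (· ∈ S)
    (List.finRange l.length) ((List.pairwise_lt_finRange _).imp fun {p q} hpq hp hq => by
      by_contra hne
      exact hq (hS (Relation.ReflTransGen.single ⟨hpq, fun hc => hne hc.symm⟩) hp))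
  rw [wordProd_append, idealWord_eq, idealWord_eq]
  unfold wordProd
  simp only [List.map_map]
  refine h.trans ?_
  congr 1
  exact List.ext_getElem (by simp) (by simp)

theorem mem_idealWord {l : List I} {S : Set (Fin l.length)} {i : I} :
    i ∈ idealWord l S ↔ ∃ p ∈ S, l.get p = i := by
  simp [idealWord]

/-- A letter of the word of an ideal of the heap preceded only by letters commuting with it
is the color of a peak of the ideal. -/
theorem exists_peak {G : SGCM I} {l : List I} {S : Set (Fin l.length)}
    (hS : JDT.IsIdeal (heapLE G l) S) {A B : List I} {i : I} (h : idealWord l S = A ++ i :: B)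
    (hA : ∀ j ∈ A, Commute (G.srefl i) (G.srefl j)) :
    ∃ q ∈ S, (∀ r ∈ S, heapLE G l q r → r = q) ∧ l.get q = i := by
  classical
  rw [idealWord_eq, List.map_eq_append_iff] at h
  obtain ⟨L₁, L₂, hL, rfl, h₂⟩ := h
  obtain ⟨q, L₃, rfl, rfl, rfl⟩ := List.map_eq_cons_iff.1 h₂
  have hmem : ∀ p, p ∈ S ↔ p ∈ L₁ ++ q :: L₃ := by
    intro p
    rw [← hL]
    simp
  have hsort : (L₁ ++ q :: L₃).Pairwise (· < ·) :=
    hL ▸ (List.pairwise_lt_finRange _).filter _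
  refine ⟨q, (hmem q).2 (by simp), fun r hr hqr => ?_, rfl⟩
  rcases hqr.cases_head with h | ⟨q', hqq', hq'r⟩
  · exact h.symm
  · exfalso
    have hq' := (hmem q').1 (hS hq'r hr)
    rw [List.pairwise_append, List.pairwise_cons] at hsort
    rcases List.mem_append.1 hq' with h | h
    · exact hqq'.2 (hA _ (List.mem_map_of_mem h))
    · have hlt : q' < q := hqq'.1
      rcases List.mem_cons.1 h with rfl | h
      · exact lt_irrefl _ hlt
      · exact lt_asymm hlt (hsort.2.1.1 q' h)

end SGCM

end KM

/-- Let `Λ` be dominant, let `x ≤ w` be `Λ`-(co)minuscule elements, and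
identify the heap `H(x)` with an order ideal `S` of the heap `H(w)` of a reduced word
`lw` of `w` (so that the product of the subword of `lw` indexed by `S` is `x`). If no
element of `H(w) ∖ H(x)` has its colour among the colours of the peaks of `H(x)`, then
`w ∈ W_x · x`, i.e. `w = u x` for some `u` in the subgroup `W_x` generated by the simple
reflections `s_α` with `⟨x(Λ), α^∨⟩ ≥ 0`. -/
theorem statement5 {I : Type} (G : KM.SGCM I) (Λ : I → ℝ) (hdom : ∀ i, 0 ≤ Λ i)
    (x w : Equiv.Perm (I → ℝ)) (hx : G.IsCoMin Λ x) (hw : G.IsCoMin Λ w)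
    (lw : List I) (hred : G.IsReduced lw) (hlw : G.wordProd lw = w)
    (S : Set (Fin lw.length))
    (hSid : KM.JDT.IsIdeal (KM.heapLE G lw) S)
    (hSx : G.wordProd (KM.idealWord lw S) = x)
    (hcol : ∀ p : Fin lw.length, p ∉ S →
      ∀ q ∈ S, (∀ r ∈ S, KM.heapLE G lw q r → r = q) → lw.get p ≠ lw.get q) :
    ∃ u ∈ Subgroup.closure
        {p : Equiv.Perm (I → ℝ) | ∃ α, 0 ≤ x Λ α ∧ p = G.srefl α},
      w = u * x := by
  have hdecomp := KM.SGCM.wordProd_idealWord_compl_append hSid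
  have hred' : G.IsReduced (KM.idealWord lw Sᶜ ++ KM.idealWord lw S) := by
    unfold KM.SGCM.IsReduced at *
    rw [hdecomp, hred, List.length_append, KM.SGCM.length_idealWord_compl_add]
  refine ⟨G.wordProd (KM.idealWord lw Sᶜ), ?_, ?_⟩
  · refine Subgroup.list_prod_mem _ fun s hs => ?_
    obtain ⟨i, hi, rfl⟩ := List.mem_map.1 hs
    obtain ⟨p, hp, rfl⟩ := KM.SGCM.mem_idealWord.1 hi
    refine Subgroup.subset_closure ⟨_, ?_, rfl⟩
    by_contra! hneg
    rw [← hSx] at hneg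
    obtain ⟨A, B, hAB, hA⟩ :=
      hw.exists_eq_append hdom hred' (hdecomp.trans hlw) hneg
    obtain ⟨q, hq, hpeak, hcolor⟩ := KM.SGCM.exists_peak hSid hAB hA
    exact hcol p hp q hq hpeak hcolor.symm
  · rw [← hSx, ← KM.SGCM.wordProd_append, hdecomp, hlw]
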